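/- arXiv:1204.5251 — 5 statements merged into one kernel-verified Lean document; each statement's English description precedes it below -/
import Mathlib

section
/- Let q be a prime, let P be a finite set of primes with q ∉ P, and let B ⊇ M^c(q) be a set of nonnegative integers. Then d(q) ≥ 1 - (1 - 1/q) · ∏_{p ∈ P} [(1 - 1/p) · Σ_{b ∈ B} 1/p^b]. -/
open Filter Topology

/-- `TowerMem q n` means that the prime `q` occurs somewhere in the tower
factorization of the positive integer `n`:  `1 ∉ M(q)`, and for `n ≥ 2`,
`n ∈ M(q)` iff `q ∣ n` or some exponent in the prime factorization of `n`
lies in `M(q)`. -/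
inductive TowerMem (q : ℕ) : ℕ → Prop
  | base (n : ℕ) (hn : 2 ≤ n) (hdvd : q ∣ n) : TowerMem q n
  | step (n p : ℕ) (hn : 2 ≤ n) (hp : p.Prime) (hdvd : p ∣ n)
      (hexp : TowerMem q (n.factorization p)) : TowerMem q n

open Classical in
/-- The proportion of the integers `{1, …, N}` that lie in `M(q)`. -/
noncomputable def towerRatio (q N : ℕ) : ℝ :=
  (((Finset.Icc 1 N).filter fun n => TowerMem q n).card : ℝ) / (N : ℝ)

open Classical in
/-- The number of elements of `A` in `{1, …, N}`. -/
noncomputable def countUpTo (A : Set ℕ) (N : ℕ) : ℕ :=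
  ((Finset.Icc 1 N).filter fun n => n ∈ A).card

/-- `A` has natural density `α`. -/
def HasNatDensity (A : Set ℕ) (α : ℝ) : Prop :=
  Tendsto (fun N : ℕ => (countUpTo A N : ℝ) / N) atTop (𝓝 α)

theorem countUpTo_le (A : Set ℕ) (N : ℕ) : countUpTo A N ≤ N := by
  classical
  simpa [countUpTo] using Finset.card_filter_le (Finset.Icc 1 N) fun n => n ∈ A

theorem countUpTo_mono {A A' : Set ℕ} (h : ∀ n, n ≠ 0 → n ∈ A → n ∈ A') (N : ℕ) :
    countUpTo A N ≤ countUpTo A' N := by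
  classical
  refine Finset.card_le_card fun n hn => ?_
  simp only [Finset.mem_filter, Finset.mem_Icc] at hn ⊢
  exact ⟨hn.1, h n (by lia) hn.2⟩

theorem hasNatDensity_univ : HasNatDensity Set.univ 1 := by
  refine tendsto_const_nhds.congr' ?_
  filter_upwards [eventually_ne_atTop 0] with N hN
  have : (N : ℝ) ≠ 0 := by exact_mod_cast hN
  simp [countUpTo, this]

theorem countUpTo_dvd {A : Set ℕ} {k : ℕ} (hk : 0 < k)
    (hA : ∀ n, n ≠ 0 → (k * n ∈ A ↔ n ∈ A)) (N : ℕ) :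
    countUpTo {n | n ∈ A ∧ k ∣ n} N = countUpTo A (N / k) := by
  classical
  symm
  refine Finset.card_bij (fun n _ => k * n) ?_ ?_ ?_
  · intro n hn
    simp only [Finset.mem_filter, Finset.mem_Icc, Set.mem_ofPred_eq] at hn ⊢
    refine ⟨⟨Nat.mul_pos hk hn.1.1, ?_⟩, (hA n (by lia)).2 hn.2, dvd_mul_right k n⟩
    have := (Nat.le_div_iff_mul_le hk).1 hn.1.2
    rwa [mul_comm]
  · intro a _ b _ h
    exact Nat.eq_of_mul_eq_mul_left hk h
  · intro m hm
    simp only [Finset.mem_filter, Finset.mem_Icc, Set.mem_ofPred_eq] at hm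
    obtain ⟨⟨h1, h2⟩, h3, n, rfl⟩ := hm
    have hn : n ≠ 0 := by rintro rfl; simp at h1
    refine ⟨n, ?_, rfl⟩
    simp only [Finset.mem_filter, Finset.mem_Icc]
    refine ⟨⟨by lia, (Nat.le_div_iff_mul_le hk).2 (by rwa [mul_comm])⟩, (hA n hn).1 h3⟩

theorem HasNatDensity.dvd {A : Set ℕ} {α : ℝ} (h : HasNatDensity A α) {k : ℕ} (hk : 0 < k)
    (hA : ∀ n, n ≠ 0 → (k * n ∈ A ↔ n ∈ A)) :
    HasNatDensity {n | n ∈ A ∧ k ∣ n} (α * (1 / (k : ℝ))) := by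
  have hdiv : Tendsto (fun N : ℕ => N / k) atTop atTop :=
    Nat.tendsto_div_const_atTop hk.ne'
  have hratio : Tendsto (fun N : ℕ => ((N / k : ℕ) : ℝ) / N) atTop (𝓝 (1 / (k : ℝ))) := by
    have := (tendsto_nat_floor_mul_div_atTop (R := ℝ) (a := 1 / (k : ℝ)) (by positivity)).comp
      tendsto_natCast_atTop_atTop
    refine this.congr fun N => ?_
    simp only [Function.comp]
    rw [one_div_mul_eq_div, Nat.floor_div_natCast, Nat.floor_natCast]
  refine ((h.comp hdiv).mul hratio).congr' ?_
  filter_upwards [hdiv.eventually_ne_atTop 0] with N hN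
  have : ((N / k : ℕ) : ℝ) ≠ 0 := by exact_mod_cast hN
  rw [countUpTo_dvd hk hA]
  simp only [Function.comp]
  exact div_mul_div_cancel₀ this

theorem countUpTo_factorization_eq_add {A : Set ℕ} {p : ℕ} (hp : p.Prime) (b N : ℕ) :
    countUpTo {n | n ∈ A ∧ n.factorization p = b} N + countUpTo {n | n ∈ A ∧ p ^ (b + 1) ∣ n} N =
      countUpTo {n | n ∈ A ∧ p ^ b ∣ n} N := by
  classical
  unfold countUpTo
  rw [← Finset.card_union_of_disjoint]
  · congr 1
    ext n
    simp only [Finset.mem_union, Finset.mem_filter, Finset.mem_Icc, Set.mem_ofPred_eq]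
    by_cases hn : n = 0
    · simp [hn]
    rw [hp.pow_dvd_iff_le_factorization hn, hp.pow_dvd_iff_le_factorization hn]
    grind
  · rw [Finset.disjoint_left]
    intro n h1 h2
    simp only [Finset.mem_filter, Finset.mem_Icc, Set.mem_ofPred_eq] at h1 h2
    rw [hp.pow_dvd_iff_le_factorization (by lia)] at h2
    lia

theorem HasNatDensity.factorization_eq {A : Set ℕ} {α : ℝ} (h : HasNatDensity A α) {p : ℕ}
    (hp : p.Prime) (hA : ∀ b n, n ≠ 0 → (p ^ b * n ∈ A ↔ n ∈ A)) (b : ℕ) :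
    HasNatDensity {n | n ∈ A ∧ n.factorization p = b}
      (α * ((1 - 1 / (p : ℝ)) * (1 / (p : ℝ) ^ b))) := by
  have h1 := h.dvd (pow_pos hp.pos b) (hA b)
  have h2 := h.dvd (pow_pos hp.pos (b + 1)) (hA (b + 1))
  have hp0 : (p : ℝ) ≠ 0 := by exact_mod_cast hp.ne_zero
  have hlim : α * ((1 - 1 / (p : ℝ)) * (1 / (p : ℝ) ^ b)) =
      α * (1 / ((p ^ b : ℕ) : ℝ)) - α * (1 / ((p ^ (b + 1) : ℕ) : ℝ)) := by
    push_cast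
    field_simp
    ring
  unfold HasNatDensity
  rw [hlim]
  refine (h1.sub h2).congr fun N => ?_
  rw [← countUpTo_factorization_eq_add hp b N]
  push_cast
  ring

theorem countUpTo_factorization_mem (A B : Set ℕ) (p N : ℕ) :
    (countUpTo {n | n ∈ A ∧ n.factorization p ∈ B} N : ℝ) =
      ∑' b, B.indicator
        (fun b => (countUpTo {n | n ∈ A ∧ n.factorization p = b} N : ℝ)) b := by
  classical
  rw [tsum_eq_sum (s := Finset.range (N + 1))]
  · unfold countUpTo
    rw [Finset.card_eq_sum_card_fiberwise (f := fun n => n.factorization p)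
      (t := Finset.range (N + 1))]
    · push_cast
      refine Finset.sum_congr rfl fun b _ => ?_
      by_cases hb : b ∈ B
      · rw [Set.indicator_of_mem hb, Finset.filter_filter]
        congr 2
        ext n
        simp only [Finset.mem_filter, Set.mem_ofPred_eq]
        grind
      · rw [Set.indicator_of_notMem hb, Nat.cast_eq_zero, Finset.card_eq_zero,
          Finset.eq_empty_iff_forall_notMem]
        simp only [Finset.mem_filter, Set.mem_ofPred_eq]
        grind
    · intro n hn
      simp only [Finset.coe_filter, Finset.mem_Icc, Set.mem_ofPred_eq] at hn
      have := Nat.factorization_lt (n := n) p (by lia)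
      simp only [Finset.coe_range, Set.mem_Iio]
      lia
  · intro b hb
    refine Set.indicator_apply_eq_zero.2 fun _ => ?_
    rw [Nat.cast_eq_zero, countUpTo, Finset.card_eq_zero, Finset.eq_empty_iff_forall_notMem]
    intro n hn
    simp only [Finset.mem_filter, Finset.mem_Icc, Set.mem_ofPred_eq] at hn
    have := Nat.factorization_lt (n := n) p (by lia)
    simp only [Finset.mem_range] at hb
    lia

theorem HasNatDensity.factorization_mem {A : Set ℕ} {α : ℝ} (h : HasNatDensity A α) {p : ℕ}
    (hp : p.Prime) (hA : ∀ b n, n ≠ 0 → (p ^ b * n ∈ A ↔ n ∈ A)) (B : Set ℕ) :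
    HasNatDensity {n | n ∈ A ∧ n.factorization p ∈ B}
      (α * ((1 - 1 / (p : ℝ)) * ∑' b : B, 1 / (p : ℝ) ^ (b : ℕ))) := by
  have hp0 : (0 : ℝ) < p := by exact_mod_cast hp.pos
  have hp1 : (1 : ℝ) < p := by exact_mod_cast hp.one_lt
  rw [tsum_subtype B (fun b : ℕ => 1 / (p : ℝ) ^ b), ← tsum_mul_left, ← tsum_mul_left]
  have hsum : Summable fun b : ℕ => (1 / (p : ℝ)) ^ b :=
    summable_geometric_of_lt_one (by positivity) ((div_lt_one hp0).2 hp1)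
  have key := tendsto_tsum_of_dominated_convergence (𝓕 := atTop)
    (f := fun (N : ℕ) (b : ℕ) => B.indicator
      (fun b => (countUpTo {n | n ∈ A ∧ n.factorization p = b} N : ℝ)) b / N)
    (g := fun b => α * ((1 - 1 / (p : ℝ)) * B.indicator (fun b : ℕ => 1 / (p : ℝ) ^ b) b))
    hsum ?_ ?_
  · refine key.congr fun N => ?_
    rw [tsum_div_const, countUpTo_factorization_mem]
  · intro b
    by_cases hb : b ∈ B
    · simpa [hb, HasNatDensity] using h.factorization_eq hp hA b
    · simp [hb]
  · refine Eventually.of_forall fun N b => ?_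
    by_cases hb : b ∈ B
    · rw [Set.indicator_of_mem hb, Real.norm_of_nonneg (by positivity)]
      refine div_le_of_le_mul₀ (by positivity) (by positivity) ?_
      have h1 : countUpTo {n | n ∈ A ∧ n.factorization p = b} N ≤ N / p ^ b := by
        refine le_trans ?_ (countUpTo_le A (N / p ^ b))
        rw [← countUpTo_dvd (pow_pos hp.pos b) (hA b), ← countUpTo_factorization_eq_add hp b N]
        exact Nat.le_add_right _ _
      calc (countUpTo {n | n ∈ A ∧ n.factorization p = b} N : ℝ)
          ≤ ((N / p ^ b : ℕ) : ℝ) := by exact_mod_cast h1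
        _ ≤ (N : ℝ) / ((p ^ b : ℕ) : ℝ) := Nat.cast_div_le
        _ = (1 / (p : ℝ)) ^ b * N := by push_cast; rw [one_div_pow]; ring
    · simp only [Set.indicator_of_notMem hb, zero_div, norm_zero]
      positivity

/-- The density of the integers whose exponent at each `p ∈ P` lies in a prescribed set `B p`. -/
theorem hasNatDensity_forall_factorization_mem (P : Finset ℕ) (hP : ∀ p ∈ P, Nat.Prime p)
    (B : ℕ → Set ℕ) :
    HasNatDensity {n | ∀ p ∈ P, n.factorization p ∈ B p}
      (∏ p ∈ P, ((1 - 1 / (p : ℝ)) * ∑' b : B p, 1 / (p : ℝ) ^ (b : ℕ))) := by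
  induction P using Finset.induction_on with
  | empty => simpa using hasNatDensity_univ
  | insert p P hpP ih =>
    have hp := hP p (Finset.mem_insert_self p P)
    have hinv : ∀ b n, n ≠ 0 → (p ^ b * n ∈ {n : ℕ | ∀ r ∈ P, n.factorization r ∈ B r} ↔
        n ∈ {n : ℕ | ∀ r ∈ P, n.factorization r ∈ B r}) := by
      intro b n hn
      refine forall₂_congr fun r hr => ?_
      have hne : p ≠ r := by rintro rfl; exact hpP hr
      rw [Nat.factorization_mul (pow_ne_zero b hp.ne_zero) hn, hp.factorization_pow]
      simp [hne]
    have := (ih fun r hr => hP r (Finset.mem_insert_of_mem hr)).factorization_mem hp hinv (B p)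
    rw [Finset.prod_insert hpP, mul_comm]
    convert this using 2
    ext n
    simp [and_comm]

theorem not_towerMem_of_lt_two {q n : ℕ} (hn : n < 2) : ¬ TowerMem q n := by
  intro h
  cases h <;> lia

theorem not_dvd_of_not_towerMem {q n : ℕ} (hq : q.Prime) (hn : n ≠ 0) (h : ¬ TowerMem q n) :
    ¬ q ∣ n := fun hdvd =>
  h (.base n (hq.two_le.trans (Nat.le_of_dvd (Nat.pos_of_ne_zero hn) hdvd)) hdvd)

theorem not_towerMem_factorization {q n p : ℕ} (hp : p.Prime) (hn : n ≠ 0)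
    (h : ¬ TowerMem q n) : ¬ TowerMem q (n.factorization p) := by
  by_cases hdvd : p ∣ n
  · exact fun hmem =>
      h (.step n p (hp.two_le.trans (Nat.le_of_dvd (Nat.pos_of_ne_zero hn) hdvd)) hp hdvd hmem)
  · rw [Nat.factorization_eq_zero_of_not_dvd hdvd]
    exact not_towerMem_of_lt_two (by norm_num)

theorem towerRatio_eq_one_sub (q : ℕ) {N : ℕ} (hN : N ≠ 0) :
    towerRatio q N = 1 - (countUpTo {n | ¬ TowerMem q n} N : ℝ) / N := by
  classical
  have h := Finset.card_filter_add_card_filter_not (s := Finset.Icc 1 N) fun n => TowerMem q n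
  rw [Nat.card_Icc, Nat.add_sub_cancel] at h
  have hN' : (N : ℝ) ≠ 0 := by exact_mod_cast hN
  rw [eq_sub_iff_add_eq, towerRatio, countUpTo, ← add_div, div_eq_one_iff_eq hN']
  simp only [Set.mem_ofPred_eq]
  exact_mod_cast h

theorem tower_density_lower_bound_finite_compl (q : ℕ) (hq : q.Prime)
    (P : Finset ℕ) (hP : ∀ p ∈ P, Nat.Prime p) (hqP : q ∉ P)
    (B : Set ℕ) (hB : {m | ¬ TowerMem q m} ⊆ B)
    (d : ℝ) (hd : Tendsto (towerRatio q) atTop (𝓝 d)) :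
    d ≥ 1 - (1 - 1 / (q : ℝ)) *
      ∏ p ∈ P, ((1 - 1 / (p : ℝ)) * ∑' b : B, 1 / (p : ℝ) ^ (b : ℕ)) := by
  set B' : ℕ → Set ℕ := Function.update (fun _ => B) q {0} with hB'
  have hB'q : B' q = {0} := Function.update_self ..
  have hB'P : ∀ p ∈ P, B' p = B := fun p hp =>
    Function.update_of_ne (by rintro rfl; exact hqP hp) ..
  have hdens := hasNatDensity_forall_factorization_mem (insert q P) (by simpa [hq] using hP) B'
  have hprod : ∏ p ∈ insert q P, ((1 - 1 / (p : ℝ)) * ∑' b : B' p, 1 / (p : ℝ) ^ (b : ℕ)) =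
      (1 - 1 / (q : ℝ)) * ∏ p ∈ P, ((1 - 1 / (p : ℝ)) * ∑' b : B, 1 / (p : ℝ) ^ (b : ℕ)) := by
    rw [Finset.prod_insert hqP, hB'q, tsum_singleton 0 fun b : ℕ => 1 / (q : ℝ) ^ b]
    congr 1
    · simp
    · exact Finset.prod_congr rfl fun p hp => by rw [hB'P p hp]
  rw [hprod] at hdens
  have hsub : ∀ n, n ≠ 0 → n ∈ {n | ¬ TowerMem q n} →
      n ∈ {n : ℕ | ∀ p ∈ insert q P, n.factorization p ∈ B' p} := by
    intro n hn hmem p hp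
    rcases Finset.mem_insert.1 hp with rfl | hp
    · rw [hB'q]
      exact Nat.factorization_eq_zero_of_not_dvd (not_dvd_of_not_towerMem hq hn hmem)
    · rw [hB'P p hp]
      exact hB (not_towerMem_factorization (hP p hp) hn hmem)
  refine le_of_tendsto_of_tendsto (tendsto_const_nhds.sub hdens) hd ?_
  filter_upwards [eventually_ne_atTop 0] with N hN
  rw [towerRatio_eq_one_sub q hN]
  have := countUpTo_mono hsub N
  gcongr
end

section
/- For every prime q, 1 - ((q^{q+1} - q^q)/(q^{q+1} - 1)) · (1/ζ(q+1)) ≤ d(q) ≤ 1 - ((q^q - q^{q-1})/(q^q - 1)) · (1/ζ(q)), where ζ is the Riemann zeta function. -/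
open Filter Topology

/-- The Riemann zeta function, given for real `s > 1` by `∑' n, n⁻ˢ`. -/
noncomputable def zetaReal (s : ℝ) : ℝ := ∑' n : ℕ, 1 / ((n : ℝ) + 1) ^ s

section NaturalDensity

/-- The set `A` has natural density `δ`. -/
def HasDensity (A : Set ℕ) (δ : ℝ) : Prop :=
  Tendsto (fun N : ℕ => (countUpTo A N : ℝ) / N) atTop (𝓝 δ)

theorem countUpTo_le_of_imp {A B : Set ℕ} {N : ℕ}
    (h : ∀ n, 0 < n → n ∈ A → n ∈ B) : countUpTo A N ≤ countUpTo B N := by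
  refine Finset.card_le_card fun n hn => ?_
  simp only [Finset.mem_filter, Finset.mem_Icc] at hn ⊢
  exact ⟨hn.1, h n (by omega) hn.2⟩

theorem countUpTo_inter_add_diff (A B : Set ℕ) (N : ℕ) :
    countUpTo (A ∩ B) N + countUpTo (A \ B) N = countUpTo A N := by
  classical
  unfold countUpTo
  rw [← Finset.card_filter_add_card_filter_not (s := (Finset.Icc 1 N).filter (· ∈ A)) (· ∈ B),
    Finset.filter_filter, Finset.filter_filter]
  congr!

theorem countUpTo_inter_dvd {A : Set ℕ} {k : ℕ} (hk : 0 < k)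
    (hA : ∀ n, k * n ∈ A ↔ n ∈ A) (N : ℕ) :
    countUpTo (A ∩ {n | k ∣ n}) N = countUpTo A (N / k) := by
  classical
  symm
  unfold countUpTo
  refine Finset.card_bij (fun n _ => k * n) ?_ ?_ ?_
  · intro n hn
    simp only [Finset.mem_filter, Finset.mem_Icc, Set.mem_inter_iff, Set.mem_ofPred_eq] at hn ⊢
    refine ⟨⟨Nat.mul_pos hk hn.1.1, ?_⟩, (hA n).2 hn.2, dvd_mul_right k n⟩
    rw [mul_comm]
    exact (Nat.le_div_iff_mul_le hk).1 hn.1.2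
  · intro a _ b _ hab
    exact Nat.eq_of_mul_eq_mul_left hk hab
  · intro b hb
    simp only [Finset.mem_filter, Finset.mem_Icc, Set.mem_inter_iff, Set.mem_ofPred_eq] at hb
    obtain ⟨⟨hb1, hbN⟩, hbA, n, rfl⟩ := hb
    refine ⟨n, ?_, rfl⟩
    simp only [Finset.mem_filter, Finset.mem_Icc]
    refine ⟨⟨Nat.pos_of_mul_pos_left hb1, ?_⟩, (hA n).1 hbA⟩
    rw [Nat.le_div_iff_mul_le hk, mul_comm]
    exact hbN

theorem countUpTo_univ (N : ℕ) : countUpTo Set.univ N = N := by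
  simp [countUpTo]

theorem hasDensity_univ : HasDensity Set.univ 1 := by
  refine tendsto_const_nhds.congr' ?_
  filter_upwards [eventually_gt_atTop 0] with N hN
  rw [countUpTo_univ, div_self (by positivity)]

theorem HasDensity.inter_dvd {A : Set ℕ} {δ : ℝ} (h : HasDensity A δ) {k : ℕ} (hk : 0 < k)
    (hA : ∀ n, k * n ∈ A ↔ n ∈ A) : HasDensity (A ∩ {n | k ∣ n}) (δ * (k : ℝ)⁻¹) := by
  have hdiv : Tendsto (fun N : ℕ => N / k) atTop atTop := Nat.tendsto_div_const_atTop hk.ne'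
  have hfloor : Tendsto (fun N : ℕ => ((N / k : ℕ) : ℝ) / N) atTop (𝓝 (k : ℝ)⁻¹) := by
    have := (tendsto_nat_floor_mul_div_atTop (R := ℝ) (a := (k : ℝ)⁻¹) (by positivity)).comp
      tendsto_natCast_atTop_atTop
    refine this.congr fun N => ?_
    simp only [Function.comp_apply]
    rw [inv_mul_eq_div, Nat.floor_div_natCast, Nat.floor_natCast]
  refine ((h.comp hdiv).mul hfloor).congr' ?_
  filter_upwards [hdiv.eventually_gt_atTop 0] with N hN
  have : ((N / k : ℕ) : ℝ) ≠ 0 := by positivity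
  rw [Function.comp_apply, countUpTo_inter_dvd hk hA, div_mul_div_cancel₀ this]

theorem HasDensity.diff {A B : Set ℕ} {δ ε : ℝ} (hA : HasDensity A δ)
    (hB : HasDensity (A ∩ B) ε) : HasDensity (A \ B) (δ - ε) := by
  refine (Tendsto.sub hA hB).congr fun N => ?_
  rw [← countUpTo_inter_add_diff A B N]
  push_cast
  ring

theorem pow_mul_mem_iff {A : Set ℕ} {p : ℕ} (hA : ∀ n, p * n ∈ A ↔ n ∈ A) (a n : ℕ) :
    p ^ a * n ∈ A ↔ n ∈ A := by
  induction a with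
  | zero => simp
  | succ a ih => rw [pow_succ', mul_assoc, hA, ih]

theorem HasDensity.inter_pow_dvd {A : Set ℕ} {δ : ℝ} (h : HasDensity A δ) {p : ℕ} (hp : 0 < p)
    (hA : ∀ n, p * n ∈ A ↔ n ∈ A) (a : ℕ) :
    HasDensity (A ∩ {n | p ^ a ∣ n}) (δ * ((p : ℝ) ^ a)⁻¹) := by
  simpa using h.inter_dvd (pow_pos hp a) (pow_mul_mem_iff hA a)

theorem HasDensity.diff_pow_dvd {A : Set ℕ} {δ : ℝ} (h : HasDensity A δ) {p : ℕ} (hp : 0 < p)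
    (hA : ∀ n, p * n ∈ A ↔ n ∈ A) (a : ℕ) :
    HasDensity (A ∩ {n | ¬ p ^ a ∣ n}) (δ * (1 - ((p : ℝ) ^ a)⁻¹)) := by
  have := h.diff (h.inter_pow_dvd hp hA a)
  rwa [← mul_one_sub] at this

theorem HasDensity.diff_exact_pow_dvd {A : Set ℕ} {δ : ℝ} (h : HasDensity A δ) {p : ℕ}
    (hp : 0 < p) (hA : ∀ n, p * n ∈ A ↔ n ∈ A) (a : ℕ) :
    HasDensity (A ∩ {n | ¬ (p ^ a ∣ n ∧ ¬ p ^ (a + 1) ∣ n)})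
      (δ * (1 - ((p : ℝ) ^ a)⁻¹ + ((p : ℝ) ^ (a + 1))⁻¹)) := by
  have hsub : (A ∩ {n | p ^ a ∣ n}) ∩ {n | p ^ (a + 1) ∣ n} = A ∩ {n | p ^ (a + 1) ∣ n} := by
    ext n
    simp only [Set.mem_inter_iff, Set.mem_ofPred_eq]
    exact ⟨fun h => ⟨h.1.1, h.2⟩, fun h => ⟨⟨h.1, (pow_dvd_pow p a.le_succ).trans h.2⟩, h.2⟩⟩
  have hexact := (h.inter_pow_dvd hp hA a).diff
    (B := {n | p ^ (a + 1) ∣ n}) (hsub ▸ h.inter_pow_dvd hp hA (a + 1))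
  have hset : A ∩ ((A ∩ {n | p ^ a ∣ n}) \ {n | p ^ (a + 1) ∣ n}) =
      (A ∩ {n | p ^ a ∣ n}) \ {n | p ^ (a + 1) ∣ n} :=
    Set.inter_eq_right.2 fun n hn => hn.1.1
  have := h.diff (B := (A ∩ {n | p ^ a ∣ n}) \ {n | p ^ (a + 1) ∣ n}) (hset ▸ hexact)
  convert this using 1
  · ext n
    simp only [Set.mem_inter_iff, Set.mem_ofPred_eq, Set.mem_sdiff]
    tauto
  · ring

/-- Conditions at distinct primes are independent, as soon as each of them is insensitive to
multiplication by the other primes. -/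
theorem hasDensity_forall_prime (S : Finset ℕ) (hS : ∀ p ∈ S, p.Prime) (Q : ℕ → ℕ → Prop)
    (f : ℕ → ℝ)
    (hQ : ∀ p r : ℕ, p.Prime → r.Prime → r ≠ p → ∀ n, Q p (r * n) ↔ Q p n)
    (hf : ∀ p : ℕ, p.Prime → ∀ (A : Set ℕ) (δ : ℝ), (∀ n, p * n ∈ A ↔ n ∈ A) →
      HasDensity A δ → HasDensity (A ∩ {n | Q p n}) (δ * f p)) :
    HasDensity {n | ∀ p ∈ S, Q p n} (∏ p ∈ S, f p) := by
  induction S using Finset.induction_on with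
  | empty => simpa using hasDensity_univ
  | insert p S hpS ih =>
    have hp := hS p (Finset.mem_insert_self p S)
    have hS' : ∀ r ∈ S, r.Prime := fun r hr => hS r (Finset.mem_insert_of_mem hr)
    have hinv : ∀ n, p * n ∈ {n | ∀ r ∈ S, Q r n} ↔ n ∈ {n | ∀ r ∈ S, Q r n} := fun n =>
      forall₂_congr fun r hr => hQ r p (hS' r hr) hp (fun h => hpS (h ▸ hr)) n
    have := hf p hp _ _ hinv (ih hS')
    rw [Finset.prod_insert hpS, mul_comm]
    convert this using 1
    ext n
    simp only [Finset.forall_mem_insert, Set.mem_inter_iff, Set.mem_ofPred_eq]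
    tauto

theorem prime_pow_dvd_prime_mul_iff {p r : ℕ} (hp : p.Prime) (hr : r.Prime) (h : r ≠ p)
    (a n : ℕ) : p ^ a ∣ r * n ↔ p ^ a ∣ n :=
  (((Nat.coprime_primes hp hr).2 h.symm).pow_left a).dvd_mul_left

theorem countUpTo_exists_pow_dvd_le {k : ℕ} (hk : 2 ≤ k) {P : ℕ} (hP : 0 < P) (N : ℕ) :
    (countUpTo {n | ∃ m, P ≤ m ∧ m ^ k ∣ n} N : ℝ) ≤
      N * ∑' m : ℕ, (((m + P : ℕ) : ℝ) ^ k)⁻¹ := by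
  classical
  have hsum : Summable fun m : ℕ => (((m + P : ℕ) : ℝ) ^ k)⁻¹ :=
    (summable_nat_add_iff (f := fun m : ℕ => ((m : ℝ) ^ k)⁻¹) P).2
      (Real.summable_nat_pow_inv.2 (by omega))
  have hcount : countUpTo {n | ∃ m, P ≤ m ∧ m ^ k ∣ n} N ≤
      ∑ m ∈ Finset.range (N + 1), N / (m + P) ^ k := by
    have hcover : (Finset.Icc 1 N).filter (· ∈ {n | ∃ m, P ≤ m ∧ m ^ k ∣ n}) ⊆
        (Finset.range (N + 1)).biUnion fun m =>
          (Finset.Icc 1 N).filter (· ∈ Set.univ ∩ {n | (m + P) ^ k ∣ n}) := by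
      intro n hn
      simp only [Finset.mem_filter, Finset.mem_Icc, Set.mem_ofPred_eq] at hn
      obtain ⟨⟨hn1, hnN⟩, m, hPm, hm⟩ := hn
      have hmn : m ≤ n := (Nat.le_self_pow (by omega) m).trans (Nat.le_of_dvd hn1 hm)
      simp only [Finset.mem_biUnion, Finset.mem_range, Finset.mem_filter, Finset.mem_Icc,
        Set.univ_inter, Set.mem_ofPred_eq]
      exact ⟨m - P, by omega, ⟨hn1, hnN⟩, by rwa [Nat.sub_add_cancel hPm]⟩
    refine (Finset.card_le_card hcover).trans (Finset.card_biUnion_le.trans ?_)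
    refine Finset.sum_le_sum fun m _ => le_of_eq ?_
    have := countUpTo_inter_dvd (A := Set.univ) (k := (m + P) ^ k) (by positivity) (by simp) N
    rw [countUpTo_univ] at this
    rw [← this, countUpTo]
    congr!
  calc (countUpTo {n | ∃ m, P ≤ m ∧ m ^ k ∣ n} N : ℝ)
      ≤ ((∑ m ∈ Finset.range (N + 1), N / (m + P) ^ k : ℕ) : ℝ) := by exact_mod_cast hcount
    _ ≤ ∑ m ∈ Finset.range (N + 1), (N : ℝ) * (((m + P : ℕ) : ℝ) ^ k)⁻¹ := by
        rw [Nat.cast_sum]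
        refine Finset.sum_le_sum fun m _ => Nat.cast_div_le.trans (le_of_eq ?_)
        rw [div_eq_mul_inv, Nat.cast_pow]
    _ ≤ N * ∑' m : ℕ, (((m + P : ℕ) : ℝ) ^ k)⁻¹ := by
        rw [← Finset.mul_sum]
        exact mul_le_mul_of_nonneg_left (hsum.sum_le_tsum _ fun _ _ => by positivity)
          (Nat.cast_nonneg N)

end NaturalDensity

section EulerProduct

theorem tendsto_prod_one_sub_inv_pow {k : ℕ} (hk : 2 ≤ k) :
    Tendsto (fun P : ℕ => ∏ p ∈ P.primesBelow, (1 - ((p : ℝ) ^ k)⁻¹)) atTop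
      (𝓝 (1 / zetaReal k)) := by
  let f : ℕ →*₀ ℝ :=
    { toFun := fun n => ((n : ℝ) ^ k)⁻¹
      map_zero' := by simp [show k ≠ 0 by omega]
      map_one' := by simp
      map_mul' := fun m n => by push_cast; rw [mul_pow, mul_inv] }
  have hf : Summable fun n : ℕ => ((n : ℝ) ^ k)⁻¹ := Real.summable_nat_pow_inv.2 (by omega)
  have hzeta : ∑' n, f n = zetaReal k := by
    change ∑' n : ℕ, ((n : ℝ) ^ k)⁻¹ = _
    rw [hf.tsum_eq_zero_add, zetaReal]
    simp [show k ≠ 0 by omega, Real.rpow_natCast]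
  have hpos : 0 < ∑' n, f n :=
    hf.tsum_pos (fun n => by positivity) 1 (by simp)
  have := (EulerProduct.eulerProduct_completely_multiplicative (f := f) hf.norm).inv₀ hpos.ne'
  rw [hzeta, ← one_div] at this
  refine this.congr fun P => ?_
  rw [← Finset.prod_inv_distrib]
  exact Finset.prod_congr rfl fun p _ => inv_inv _

theorem tendsto_prod_one_sub_inv_pow_ite {k q : ℕ} (hk : 2 ≤ k) (hq : q.Prime) :
    Tendsto (fun P : ℕ => ∏ p ∈ P.primesBelow, (1 - ((p : ℝ) ^ (if p = q then 1 else k))⁻¹))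
      atTop (𝓝 (((q : ℝ) ^ k - (q : ℝ) ^ (k - 1)) / ((q : ℝ) ^ k - 1) * (1 / zetaReal k))) := by
  have hq1 : (1 : ℝ) < q := by exact_mod_cast hq.one_lt
  have hqk : (1 : ℝ) < (q : ℝ) ^ k := one_lt_pow₀ hq1 (by omega)
  refine ((tendsto_prod_one_sub_inv_pow hk).const_mul _).congr' ?_
  filter_upwards [eventually_gt_atTop q] with P hP
  have hmem : q ∈ P.primesBelow := Nat.mem_primesBelow.2 ⟨hP, hq⟩
  rw [← Finset.mul_prod_erase _ _ hmem,
    ← Finset.mul_prod_erase _ (fun p : ℕ => 1 - ((p : ℝ) ^ (if p = q then 1 else k))⁻¹) hmem,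
    ← mul_assoc]
  congr 1
  · obtain ⟨j, rfl⟩ : ∃ j, k = j + 1 := ⟨k - 1, by omega⟩
    have : (q : ℝ) ^ (j + 1) - 1 ≠ 0 := by linarith
    simp only [Nat.add_sub_cancel, if_true]
    field_simp
    ring
  · refine Finset.prod_congr rfl fun p hp => ?_
    rw [if_neg (Finset.ne_of_mem_erase hp)]

end EulerProduct

section TowerFactorization

theorem TowerMem.le {q n : ℕ} (h : TowerMem q n) : q ≤ n := by
  induction h with
  | base n hn hdvd => exact Nat.le_of_dvd (by omega) hdvd
  | step n p hn hp hdvd hexp ih => exact ih.trans (Nat.factorization_lt p (by omega)).le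

theorem TowerMem.exists_prime_pow_dvd {q n : ℕ} (hq : q.Prime) (h : TowerMem q n) :
    ∃ p : ℕ, p.Prime ∧ p ^ (if p = q then 1 else q) ∣ n := by
  cases h with
  | base n hn hdvd => exact ⟨q, hq, by simpa using hdvd⟩
  | step n p hn hp hdvd hexp =>
    refine ⟨p, hp, ?_⟩
    split_ifs
    · simpa using hdvd
    · exact (hp.pow_dvd_iff_le_factorization (by omega)).2 hexp.le

theorem TowerMem.of_exact_pow_dvd {p q n : ℕ} (hp : p.Prime) (hq : q.Prime) (hn : 0 < n)
    (h : p ^ q ∣ n) (h' : ¬ p ^ (q + 1) ∣ n) : TowerMem q n := by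
  have hpn : p ∣ n := (dvd_pow_self p hq.ne_zero).trans h
  rw [hp.pow_dvd_iff_le_factorization hn.ne'] at h h'
  have heq : n.factorization p = q := by omega
  exact .step n p (hp.two_le.trans (Nat.le_of_dvd hn hpn)) hp hpn
    (heq ▸ .base q hq.two_le dvd_rfl)

theorem hasDensity_not_towerMem {q : ℕ} {d : ℝ} (hd : Tendsto (towerRatio q) atTop (𝓝 d)) :
    HasDensity {n | ¬ TowerMem q n} (1 - d) := by
  have h := hasDensity_univ.diff (B := {n | TowerMem q n}) (ε := d) (by
    rw [Set.univ_inter]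
    exact hd)
  convert h using 1
  ext n
  simp

theorem one_sub_density_le {q : ℕ} (hq : q.Prime) {δ : ℝ}
    (hδ : HasDensity {n | ¬ TowerMem q n} δ) (P : ℕ) :
    δ ≤ ∏ p ∈ P.primesBelow, (1 - ((p : ℝ) ^ (if p = q then 1 else q + 1))⁻¹) := by
  let Q : ℕ → ℕ → Prop := fun p n =>
    if p = q then ¬ p ^ 1 ∣ n else ¬ (p ^ q ∣ n ∧ ¬ p ^ (q + 1) ∣ n)
  let f : ℕ → ℝ := fun p =>
    if p = q then 1 - ((p : ℝ) ^ 1)⁻¹ else 1 - ((p : ℝ) ^ q)⁻¹ + ((p : ℝ) ^ (q + 1))⁻¹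
  have hdens : HasDensity {n | ∀ p ∈ P.primesBelow, Q p n} (∏ p ∈ P.primesBelow, f p) := by
    refine hasDensity_forall_prime _ (fun p hp => Nat.prime_of_mem_primesBelow hp) Q f ?_ ?_
    · intro p r hp hr hrp n
      simp only [Q, prime_pow_dvd_prime_mul_iff hp hr hrp]
    · intro p hp A δ hA h
      by_cases hpq : p = q
      · simpa only [Q, f, if_pos hpq] using h.diff_pow_dvd hp.pos hA 1
      · simpa only [Q, f, if_neg hpq] using h.diff_exact_pow_dvd hp.pos hA q
  have hle : δ ≤ ∏ p ∈ P.primesBelow, f p := by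
    refine le_of_tendsto_of_tendsto' hδ hdens fun N => ?_
    gcongr
    refine countUpTo_le_of_imp fun n hn hnT p hp => ?_
    have hpp := Nat.prime_of_mem_primesBelow hp
    simp only [Q]
    split_ifs with hpq
    · rintro hdvd
      rw [hpq, pow_one] at hdvd
      exact hnT (.base n (hq.two_le.trans (Nat.le_of_dvd hn hdvd)) hdvd)
    · exact fun h => hnT (.of_exact_pow_dvd hpp hq hn h.1 h.2)
  refine hle.trans (Finset.prod_le_prod (fun p hp => ?_) fun p hp => ?_)
  all_goals
    have hpp : (2 : ℝ) ≤ p := by exact_mod_cast (Nat.prime_of_mem_primesBelow hp).two_le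
    simp only [f]
    split_ifs
  · rw [sub_nonneg]
    exact inv_le_one_of_one_le₀ (one_le_pow₀ (by linarith))
  · have h1 : ((p : ℝ) ^ q)⁻¹ ≤ 1 := inv_le_one_of_one_le₀ (one_le_pow₀ (by linarith))
    have h2 : 0 ≤ ((p : ℝ) ^ (q + 1))⁻¹ := by positivity
    linarith
  · exact le_rfl
  · have h : ((p : ℝ) ^ q)⁻¹ = p * ((p : ℝ) ^ (q + 1))⁻¹ := by
      field_simp
      ring
    have h2 : 0 ≤ ((p : ℝ) ^ (q + 1))⁻¹ := by positivity
    rw [h]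
    nlinarith

theorem le_one_sub_density_add_tail {q : ℕ} (hq : q.Prime) {δ : ℝ}
    (hδ : HasDensity {n | ¬ TowerMem q n} δ) {P : ℕ} (hP : q < P) :
    ∏ p ∈ P.primesBelow, (1 - ((p : ℝ) ^ (if p = q then 1 else q))⁻¹) ≤
      δ + ∑' m : ℕ, (((m + P : ℕ) : ℝ) ^ q)⁻¹ := by
  set A : Set ℕ := {n | ∀ p ∈ P.primesBelow, ¬ p ^ (if p = q then 1 else q) ∣ n}
  set T : Set ℕ := {n | ¬ TowerMem q n}
  have hdens : HasDensity A (∏ p ∈ P.primesBelow, (1 - ((p : ℝ) ^ (if p = q then 1 else q))⁻¹)) :=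
    hasDensity_forall_prime _ (fun p hp => Nat.prime_of_mem_primesBelow hp)
      (fun p n => ¬ p ^ (if p = q then 1 else q) ∣ n) _
      (fun p r hp hr hrp n => not_congr (prime_pow_dvd_prime_mul_iff hp hr hrp _ n))
      (fun p hp A δ hA h => h.diff_pow_dvd hp.pos hA _)
  refine le_of_tendsto_of_tendsto hdens (hδ.add_const _) ?_
  filter_upwards [eventually_gt_atTop 0] with N hN
  have hN' : (0 : ℝ) < N := by exact_mod_cast hN
  have hT : countUpTo (A ∩ T) N ≤ countUpTo T N := countUpTo_le_of_imp fun n _ h => h.2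
  have hcount : countUpTo (A \ T) N ≤ countUpTo {n | ∃ m, P ≤ m ∧ m ^ q ∣ n} N := by
    refine countUpTo_le_of_imp fun n hn h => ?_
    obtain ⟨p, hp, hpn⟩ := (not_not.1 h.2 : TowerMem q n).exists_prime_pow_dvd hq
    have hPp : P ≤ p := by
      by_contra! hlt
      exact h.1 p (Nat.mem_primesBelow.2 ⟨hlt, hp⟩) hpn
    exact ⟨p, hPp, by rwa [if_neg (by omega)] at hpn⟩
  have htail := countUpTo_exists_pow_dvd_le hq.two_le (show 0 < P by omega) N
  have hsplit := countUpTo_inter_add_diff A T N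
  rw [div_add' _ _ _ hN'.ne']
  gcongr
  have : (countUpTo A N : ℝ) ≤ countUpTo T N + countUpTo {n | ∃ m, P ≤ m ∧ m ^ q ∣ n} N := by
    exact_mod_cast (by omega)
  linarith

end TowerFactorization

theorem tower_density_asymptotic_bounds (q : ℕ) (hq : q.Prime)
    (d : ℝ) (hd : Tendsto (towerRatio q) atTop (𝓝 d)) :
    1 - (((q : ℝ) ^ (q + 1) - (q : ℝ) ^ q) / ((q : ℝ) ^ (q + 1) - 1)) *
        (1 / zetaReal (q + 1)) ≤ d ∧
    d ≤ 1 - (((q : ℝ) ^ q - (q : ℝ) ^ (q - 1)) / ((q : ℝ) ^ q - 1)) *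
        (1 / zetaReal q) := by
  have hδ := hasDensity_not_towerMem hd
  constructor
  · have hlim := tendsto_prod_one_sub_inv_pow_ite (k := q + 1) (hq.two_le.trans q.le_succ) hq
    rw [Nat.add_sub_cancel, Nat.cast_add_one] at hlim
    linarith [ge_of_tendsto' hlim (one_sub_density_le hq hδ)]
  · have hlim := tendsto_prod_one_sub_inv_pow_ite hq.two_le hq
    have htail := (tendsto_sum_nat_add fun m : ℕ => ((m : ℝ) ^ q)⁻¹).const_add (1 - d)
    have := le_of_tendsto_of_tendsto hlim htail (by
      filter_upwards [eventually_gt_atTop q] with P hP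
      exact le_one_sub_density_add_tail hq hδ hP)
    linarith
end

section
/- For every prime q, (1/2^{q+1}) · (1 - 1/q) - 1/q^q ≤ d(q) - 1/q ≤ (1/2^q) · (1 + 1/q). -/
open Filter Topology

theorem TowerMem.dvd_or_exists_prime_pow_dvd {q n : ℕ} (h : TowerMem q n) :
    q ∣ n ∨ ∃ p, p.Prime ∧ p ≠ q ∧ p ^ q ∣ n := by
  by_cases hqn : q ∣ n
  · exact Or.inl hqn
  · cases h with
    | base _ hn hdvd => exact absurd hdvd hqn
    | step _ p hn hp hdvd hexp =>
      refine Or.inr ⟨p, hp, ?_, (pow_dvd_pow p hexp.le).trans (Nat.ordProj_dvd n p)⟩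
      rintro rfl
      exact hqn hdvd

theorem card_filter_dvd_Icc (N d : ℕ) : ((Finset.Icc 1 N).filter (d ∣ ·)).card = N / d :=
  Nat.Ioc_filter_dvd_card_eq_div N d

theorem towerRatio_le_of_cover {q N : ℕ} (S : Finset ℕ)
    (hS : ∀ n ∈ Finset.Icc 1 N, TowerMem q n → q ∣ n ∨ ∃ p ∈ S, p ^ q ∣ n) :
    towerRatio q N ≤ 1 / (q : ℝ) + ∑ p ∈ S, 1 / (p : ℝ) ^ q := by
  classical
  have hsub : (Finset.Icc 1 N).filter (fun n => TowerMem q n) ⊆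
      (Finset.Icc 1 N).filter (q ∣ ·) ∪
        S.biUnion fun p => (Finset.Icc 1 N).filter (p ^ q ∣ ·) := by
    intro n hn
    rw [Finset.mem_filter] at hn
    simp only [Finset.mem_union, Finset.mem_biUnion, Finset.mem_filter]
    rcases hS n hn.1 hn.2 with h | ⟨p, hp, h⟩
    · exact Or.inl ⟨hn.1, h⟩
    · exact Or.inr ⟨p, hp, hn.1, h⟩
  have hcard : ((Finset.Icc 1 N).filter fun n => TowerMem q n).card ≤
      N / q + ∑ p ∈ S, N / p ^ q := by
    refine (Finset.card_le_card hsub).trans ((Finset.card_union_le _ _).trans ?_)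
    rw [card_filter_dvd_Icc]
    refine Nat.add_le_add_left (Finset.card_biUnion_le.trans ?_) _
    simp only [card_filter_dvd_Icc, le_refl]
  have hreal : (((Finset.Icc 1 N).filter fun n => TowerMem q n).card : ℝ) ≤
      (1 / (q : ℝ) + ∑ p ∈ S, 1 / (p : ℝ) ^ q) * N := by
    refine (Nat.cast_le.mpr hcard).trans ?_
    push_cast
    rw [add_mul, Finset.sum_mul]
    refine add_le_add ?_ (Finset.sum_le_sum fun p _ => ?_)
    · rw [one_div_mul_eq_div]
      exact Nat.cast_div_le
    · rw [one_div_mul_eq_div]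
      exact_mod_cast Nat.cast_div_le (α := ℝ) (m := N) (n := p ^ q)
  unfold towerRatio
  refine div_le_of_le_mul₀ (Nat.cast_nonneg N) (by positivity) ?_
  convert hreal

theorem sum_odd_inv_pow_le {q : ℕ} (hq : 2 ≤ q) (M : ℕ) :
    ∑ k ∈ Finset.Ico 2 M, 1 / ((2 * k + 1 : ℕ) : ℝ) ^ q ≤ 25 / 8 / 5 ^ q := by
  have key : ∀ m : ℕ, ∑ k ∈ Finset.Ico 2 (m + 2), 1 / ((2 * k + 1 : ℕ) : ℝ) ^ q ≤
      25 / 5 ^ q * (1 / 8 - 1 / (4 * ((m : ℝ) + 2))) := by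
    intro m
    induction m with
    | zero => norm_num
    | succ m ih =>
      rw [show m + 1 + 2 = (m + 2) + 1 by ring, Finset.sum_Ico_succ_top (by omega)]
      have hterm : 1 / ((2 * (m + 2) + 1 : ℕ) : ℝ) ^ q ≤
          25 / 5 ^ q * (1 / (4 * ((m : ℝ) + 2)) - 1 / (4 * ((m : ℝ) + 3))) := by
        obtain ⟨r, rfl⟩ := Nat.exists_eq_add_of_le hq
        have hpow : (5 : ℝ) ^ r ≤ (2 * m + 5) ^ r :=
          pow_le_pow_left₀ (by norm_num) (by linarith [Nat.cast_nonneg (α := ℝ) m]) r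
        have hr : (25 : ℝ) / 5 ^ (2 + r) = 1 / 5 ^ r := by
          rw [pow_add]; field_simp; norm_num
        have hsq : 1 / (2 * (m : ℝ) + 5) ^ 2 ≤
            1 / (4 * ((m : ℝ) + 2)) - 1 / (4 * ((m : ℝ) + 3)) := by
          rw [show 1 / (4 * ((m : ℝ) + 2)) - 1 / (4 * ((m : ℝ) + 3)) =
            1 / (4 * ((m : ℝ) + 2) * ((m : ℝ) + 3)) by field_simp; ring]
          exact one_div_le_one_div_of_le (by positivity) (by nlinarith)
        have hcast : ((2 * (m + 2) + 1 : ℕ) : ℝ) = 2 * m + 5 := by push_cast; ring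
        rw [hcast, hr, pow_add, mul_comm, ← one_div_mul_one_div]
        exact mul_le_mul (one_div_le_one_div_of_le (by positivity) hpow) hsq (by positivity)
          (by positivity)
      have : ((m + 1 : ℕ) : ℝ) + 2 = m + 3 := by push_cast; ring
      rw [this]
      linarith
  rcases le_total M 2 with hM | hM
  · rw [Finset.Ico_eq_empty (by omega), Finset.sum_empty]
    positivity
  · obtain ⟨m, rfl⟩ := Nat.exists_eq_add_of_le' hM
    refine (key m).trans ?_
    rw [div_right_comm, div_eq_mul_one_div _ (8 : ℝ)]
    refine mul_le_mul_of_nonneg_left ?_ (by positivity)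
    have : 0 ≤ 1 / (4 * ((m : ℝ) + 2)) := by positivity
    linarith

theorem towerRatio_le {q : ℕ} (hq : q.Prime) (N : ℕ) :
    towerRatio q N ≤
      1 / (q : ℝ) + (∑ p ∈ ({2, 3} : Finset ℕ).erase q, 1 / (p : ℝ) ^ q + 25 / 8 / 5 ^ q) := by
  refine (towerRatio_le_of_cover
    (({2, 3} : Finset ℕ).erase q ∪ (Finset.Ico 2 (N + 1)).image (fun k => 2 * k + 1)) ?_).trans ?_
  · intro n hn h
    rw [Finset.mem_Icc] at hn
    refine h.dvd_or_exists_prime_pow_dvd.imp_right ?_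
    rintro ⟨p, hp, hpq, hdvd⟩
    refine ⟨p, ?_, hdvd⟩
    have hpN : p ≤ N :=
      (Nat.le_self_pow hq.ne_zero p).trans ((Nat.le_of_dvd (by omega) hdvd).trans hn.2)
    simp only [Finset.mem_union, Finset.mem_erase, Finset.mem_insert, Finset.mem_singleton,
      Finset.mem_image, Finset.mem_Ico]
    rcases hp.eq_two_or_odd with h2 | hodd
    · exact Or.inl ⟨hpq, Or.inl h2⟩
    · by_cases h3 : p = 3
      · exact Or.inl ⟨hpq, Or.inr h3⟩
      · have := hp.two_le
        exact Or.inr ⟨p / 2, by omega, by omega⟩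
  · refine add_le_add_right ?_ _
    have himage : ∑ p ∈ (Finset.Ico 2 (N + 1)).image (fun k : ℕ => 2 * k + 1),
        1 / ((p : ℕ) : ℝ) ^ q ≤ 25 / 8 / 5 ^ q := by
      rw [Finset.sum_image (by intro a _ b _ h; dsimp only at h; omega)]
      exact sum_odd_inv_pow_le hq.two_le _
    refine le_trans ?_ (add_le_add_right himage _)
    rw [← Finset.sum_union_inter]
    exact le_add_of_nonneg_right (Finset.sum_nonneg fun p _ => by positivity)

theorem mul_pow_add_pow_le_one {q : ℕ} (hq : 5 ≤ q) :
    (q : ℝ) * ((2 / 3) ^ q + 25 / 8 * (2 / 5) ^ q) ≤ 1 := by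
  induction q, hq using Nat.le_induction with
  | base => norm_num
  | succ q hq ih =>
    refine le_trans ?_ ih
    have hq' : (5 : ℝ) ≤ q := by exact_mod_cast hq
    have h3 : (0 : ℝ) < (2 / 3) ^ q := by positivity
    have h5 : (0 : ℝ) < (2 / 5) ^ q := by positivity
    push_cast
    rw [pow_succ, pow_succ]
    nlinarith [mul_le_mul_of_nonneg_right hq' h3.le, mul_le_mul_of_nonneg_right hq' h5.le]

theorem sum_two_three_add_tail_le {q : ℕ} (hq : q.Prime) :
    ∑ p ∈ ({2, 3} : Finset ℕ).erase q, 1 / (p : ℝ) ^ q + 25 / 8 / 5 ^ q ≤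
      1 / 2 ^ q * (1 + 1 / (q : ℝ)) := by
  by_cases h2 : q = 2
  · subst h2
    rw [show ({2, 3} : Finset ℕ).erase 2 = {3} by decide]
    norm_num
  by_cases h3 : q = 3
  · subst h3
    rw [show ({2, 3} : Finset ℕ).erase 3 = {2} by decide]
    norm_num
  have h5 : 5 ≤ q := by
    have := hq.two_le
    have : q ≠ 4 := by rintro rfl; revert hq; decide
    omega
  rw [Finset.erase_eq_of_notMem (by simp [h2, h3]), Finset.sum_pair (by norm_num)]
  have hq0 : (0 : ℝ) < q := by exact_mod_cast hq.pos
  have key := mul_pow_add_pow_le_one h5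
  rw [← le_div_iff₀' hq0, div_pow, div_pow] at key
  have h := mul_le_mul_of_nonneg_left key (by positivity : (0 : ℝ) ≤ 1 / 2 ^ q)
  have hexpand : (1 : ℝ) / 2 ^ q * (2 ^ q / 3 ^ q + 25 / 8 * (2 ^ q / 5 ^ q)) =
      1 / 3 ^ q + 25 / 8 / 5 ^ q := by
    field_simp
  rw [hexpand] at h
  push_cast
  linarith

theorem towerMem_of_dvd {q n : ℕ} (hq : q.Prime) (hn : 0 < n) (h : q ∣ n) : TowerMem q n :=
  .base n (hq.two_le.trans (Nat.le_of_dvd hn h)) h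

theorem towerMem_of_two_pow_dvd {q n : ℕ} (hq : q.Prime) (h : 2 ^ q ∣ n)
    (h' : ¬ 2 ^ (q + 1) ∣ n) : TowerMem q n := by
  have hn : n ≠ 0 := by rintro rfl; exact h' (dvd_zero _)
  have h2 : 2 ∣ n := (dvd_pow_self 2 hq.ne_zero).trans h
  have hfac : n.factorization 2 = q := by
    rw [Nat.prime_two.pow_dvd_iff_le_factorization hn] at h h'
    omega
  refine .step n 2 (Nat.le_of_dvd (by omega) h2) Nat.prime_two h2 ?_
  rw [hfac]
  exact towerMem_of_dvd hq hq.pos dvd_rfl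

theorem sum_ite_dvd_Icc {N d : ℕ} (h : d ∣ N) (hd : d ≠ 0) :
    ∑ n ∈ Finset.Icc 1 N, (if d ∣ n then (1 : ℝ) else 0) = N * (1 / d) := by
  rw [Finset.sum_boole, card_filter_dvd_Icc, Nat.cast_div h (by exact_mod_cast hd),
    div_eq_mul_one_div]

theorem le_of_tendsto_towerRatio {q : ℕ} {d c : ℝ} (hd : Tendsto (towerRatio q) atTop (𝓝 d))
    {L : ℕ} (hL : 0 < L) (f : ℕ → ℝ)
    (hf : ∀ n, 0 < n → f n ≤ 1 ∧ (¬ TowerMem q n → f n ≤ 0))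
    (hsum : ∀ m, ∑ n ∈ Finset.Icc 1 (L * m), f n = (L * m : ℕ) * c) : c ≤ d := by
  classical
  have hsub : Tendsto (fun m => L * m) atTop atTop :=
    tendsto_id.const_mul_atTop' hL
  refine ge_of_tendsto (hd.comp hsub) ?_
  filter_upwards [eventually_gt_atTop 0] with m hm
  have hpos : (0 : ℝ) < (L * m : ℕ) := by exact_mod_cast Nat.mul_pos hL hm
  have hle : ((L * m : ℕ) : ℝ) * c ≤
      (((Finset.Icc 1 (L * m)).filter fun n => TowerMem q n).card : ℝ) := by
    rw [← hsum, ← Finset.sum_boole]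
    refine Finset.sum_le_sum fun n hn => ?_
    have := hf n (Finset.mem_Icc.mp hn).1
    split_ifs with h
    · exact this.1
    · exact this.2 h
  rw [Function.comp_apply, towerRatio, le_div_iff₀ hpos, mul_comm]
  convert hle

theorem one_div_le_of_tendsto_towerRatio {q : ℕ} (hq : q.Prime) {d : ℝ}
    (hd : Tendsto (towerRatio q) atTop (𝓝 d)) : 1 / (q : ℝ) ≤ d := by
  refine le_of_tendsto_towerRatio hd hq.pos (fun n => if q ∣ n then 1 else 0) ?_
    fun m => sum_ite_dvd_Icc (dvd_mul_right q m) hq.ne_zero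
  intro n hn
  by_cases h : q ∣ n
  · simp [h, towerMem_of_dvd hq hn h]
  · simp [h]

theorem lower_bound_of_tendsto_towerRatio {q : ℕ} (hq : q.Prime) (h2 : q ≠ 2) {d : ℝ}
    (hd : Tendsto (towerRatio q) atTop (𝓝 d)) :
    1 / (q : ℝ) + 1 / 2 ^ (q + 1) * (1 - 1 / (q : ℝ)) ≤ d := by
  have hcop (k : ℕ) : Nat.Coprime (2 ^ k) q :=
    ((Nat.coprime_primes Nat.prime_two hq).mpr h2.symm).pow_left k
  have hiff (k n : ℕ) : 2 ^ k * q ∣ n ↔ 2 ^ k ∣ n ∧ q ∣ n :=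
    ⟨fun h => ⟨(dvd_mul_right _ _).trans h, (dvd_mul_left _ _).trans h⟩,
      fun h => (hcop k).mul_dvd_of_dvd_of_dvd h.1 h.2⟩
  have hq0 := hq.ne_zero
  refine le_of_tendsto_towerRatio hd (L := 2 ^ (q + 1) * q)
    (Nat.mul_pos (by positivity) hq.pos)
    (fun n => (if q ∣ n then 1 else 0) + (if 2 ^ q ∣ n then 1 else 0)
      - (if 2 ^ (q + 1) ∣ n then 1 else 0) - (if 2 ^ q * q ∣ n then 1 else 0)
      + (if 2 ^ (q + 1) * q ∣ n then 1 else 0)) ?_ ?_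
  · intro n hn
    have hsucc : 2 ^ (q + 1) ∣ n → 2 ^ q ∣ n := (pow_dvd_pow 2 (Nat.le_succ q)).trans
    have hmem := towerMem_of_dvd hq hn
    have hmem' := towerMem_of_two_pow_dvd (n := n) hq
    simp only [hiff]
    by_cases ha : q ∣ n <;> by_cases hb : 2 ^ q ∣ n <;> by_cases hc : 2 ^ (q + 1) ∣ n <;>
      simp_all
  · intro m
    have hL : 2 ^ (q + 1) * q ∣ 2 ^ (q + 1) * q * m := dvd_mul_right _ _
    have hpow : 2 ^ q ∣ 2 ^ (q + 1) := pow_dvd_pow 2 (Nat.le_succ q)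
    have h1 := (dvd_mul_left q (2 ^ (q + 1))).trans hL
    have h3 := (dvd_mul_right (2 ^ (q + 1)) q).trans hL
    have h4 := (mul_dvd_mul_right hpow q).trans hL
    simp only [Finset.sum_add_distrib, Finset.sum_sub_distrib]
    rw [sum_ite_dvd_Icc h1 hq0, sum_ite_dvd_Icc (hpow.trans h3) (by positivity),
      sum_ite_dvd_Icc h3 (by positivity), sum_ite_dvd_Icc h4 (by positivity),
      sum_ite_dvd_Icc hL (by positivity)]
    have : (q : ℝ) ≠ 0 := by exact_mod_cast hq0
    push_cast
    field_simp
    ring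

theorem tower_density_near_one_over_q (q : ℕ) (hq : q.Prime)
    (d : ℝ) (hd : Tendsto (towerRatio q) atTop (𝓝 d)) :
    1 / 2 ^ (q + 1) * (1 - 1 / (q : ℝ)) - 1 / (q : ℝ) ^ q ≤ d - 1 / (q : ℝ) ∧
    d - 1 / (q : ℝ) ≤ 1 / 2 ^ q * (1 + 1 / (q : ℝ)) := by
  constructor
  · by_cases h2 : q = 2
    · subst h2
      have := one_div_le_of_tendsto_towerRatio hq hd
      norm_num at this ⊢
      linarith
    · have := lower_bound_of_tendsto_towerRatio hq h2 hd
      have hpos : (0 : ℝ) ≤ 1 / (q : ℝ) ^ q := by positivity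
      linarith
  · have := le_of_tendsto' hd (towerRatio_le hq)
    have := sum_two_three_add_tail_le hq
    linarith
end

section
/- The densities d(q) tend to 0 as the prime q tends to infinity: for every ε > 0 there exists Q such that for all primes q ≥ Q, d(q) < ε. -/
open Filter Topology

open Finset in
theorem card_filter_dvd_le_div (N r : ℕ) :
    (((Icc 1 N).filter fun n => r ∣ n).card : ℝ) ≤ N / r := by
  have h : (Icc 1 N).filter (fun n => r ∣ n) = (Ioc 0 N).filter (fun n => r ∣ n) := rfl
  rw [h, Nat.Ioc_filter_dvd_card_eq_div]
  exact Nat.cast_div_le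

theorem TowerMem.dvd_or_exists_pow_dvd {q n : ℕ} (h : TowerMem q n) :
    q ∣ n ∨ ∃ p, p.Prime ∧ p ^ q ∣ n := by
  cases h with
  | base _ hn hdvd => exact Or.inl hdvd
  | step _ p hn hp hdvd hexp =>
    exact Or.inr ⟨p, hp, (pow_dvd_pow p hexp.le).trans (Nat.ordProj_dvd n p)⟩

open Finset in
theorem sum_inv_pow_le {q : ℕ} (hq : 2 ≤ q) {N : ℕ} (hN : 1 ≤ N) :
    ∑ r ∈ Ioc 1 N, ((r : ℝ) ^ q)⁻¹ ≤ 4 / 2 ^ q := by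
  obtain ⟨k, rfl⟩ := Nat.exists_eq_add_of_le hq
  calc ∑ r ∈ Ioc 1 N, ((r : ℝ) ^ (2 + k))⁻¹
      ≤ ∑ r ∈ Ioc 1 N, ((r : ℝ) ^ 2)⁻¹ * (2 ^ k)⁻¹ := by
        refine sum_le_sum fun r hr => ?_
        have hr2 : (2 : ℝ) ≤ r := by exact_mod_cast (mem_Ioc.mp hr).1
        rw [pow_add, mul_inv]
        gcongr
    _ = (∑ r ∈ Ioc 1 N, ((r : ℝ) ^ 2)⁻¹) * (2 ^ k)⁻¹ := by rw [sum_mul]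
    _ ≤ 1 * (2 ^ k)⁻¹ := by
        gcongr
        have h := sum_Ioc_inv_sq_le_sub (α := ℝ) one_ne_zero hN
        have h0 : (0 : ℝ) ≤ (N : ℝ)⁻¹ := by positivity
        simp only [Nat.cast_one, inv_one] at h
        linarith
    _ = 4 / 2 ^ (2 + k) := by
        rw [pow_add]
        field_simp
        norm_num

open Classical Finset in
theorem towerRatio_le_s17 {q : ℕ} (hq : 2 ≤ q) {N : ℕ} (hN : 1 ≤ N) :
    towerRatio q N ≤ 5 / q := by
  have hN0 : (0 : ℝ) < N := by exact_mod_cast hN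
  have hq0 : (0 : ℝ) < q := by exact_mod_cast (by lia : 0 < q)
  have hsub : (Icc 1 N).filter (fun n => TowerMem q n) ⊆
      (Icc 1 N).filter (fun n => q ∣ n) ∪
        (Ioc 1 N).biUnion fun r => (Icc 1 N).filter fun n => r ^ q ∣ n := by
    intro n hn
    obtain ⟨hnN, ht⟩ := mem_filter.mp hn
    rcases ht.dvd_or_exists_pow_dvd with h | ⟨p, hp, h⟩
    · exact mem_union_left _ (mem_filter.mpr ⟨hnN, h⟩)
    · refine mem_union_right _ (mem_biUnion.mpr ⟨p, ?_, mem_filter.mpr ⟨hnN, h⟩⟩)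
      rw [mem_Icc] at hnN
      have h1 : p ≤ p ^ q := Nat.le_self_pow (by lia) p
      have h2 : p ^ q ≤ n := Nat.le_of_dvd (by lia) h
      exact mem_Ioc.mpr ⟨hp.one_lt, by lia⟩
  have hcard : (((Icc 1 N).filter fun n => TowerMem q n).card : ℝ) ≤
      ((Icc 1 N).filter fun n => q ∣ n).card +
        ∑ r ∈ Ioc 1 N, (((Icc 1 N).filter fun n => r ^ q ∣ n).card : ℝ) := by
    exact_mod_cast (card_le_card hsub).trans
      ((card_union_le _ _).trans (Nat.add_le_add_left card_biUnion_le _))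
  have hsum : ∑ r ∈ Ioc 1 N, (((Icc 1 N).filter fun n => r ^ q ∣ n).card : ℝ) ≤
      N * (4 / 2 ^ q) := by
    refine le_trans ?_ (mul_le_mul_of_nonneg_left (sum_inv_pow_le hq hN) hN0.le)
    rw [mul_sum]
    refine sum_le_sum fun r _ => (card_filter_dvd_le_div N (r ^ q)).trans_eq ?_
    rw [Nat.cast_pow, div_eq_mul_inv]
  have hpow : (4 : ℝ) / 2 ^ q ≤ 4 / q := by
    gcongr
    exact_mod_cast Nat.lt_two_pow_self.le
  rw [towerRatio, div_le_iff₀ hN0]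
  calc (((Icc 1 N).filter fun n => TowerMem q n).card : ℝ)
      ≤ N / q + N * (4 / q) :=
        hcard.trans (add_le_add (card_filter_dvd_le_div N q)
          (hsum.trans (mul_le_mul_of_nonneg_left hpow hN0.le)))
    _ = 5 / q * N := by ring

theorem tower_density_tendsto_zero :
    ∀ ε : ℝ, 0 < ε → ∃ Q : ℕ, ∀ q : ℕ, Nat.Prime q → Q ≤ q →
      ∀ d : ℝ, Tendsto (towerRatio q) atTop (𝓝 d) → d < ε := by
  intro ε hε
  obtain ⟨Q, hQ⟩ := exists_nat_gt (5 / ε)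
  refine ⟨Q, fun q hq hQq d hd => ?_⟩
  have hq0 : (0 : ℝ) < q := by exact_mod_cast hq.pos
  have hle : d ≤ 5 / q :=
    le_of_tendsto hd ((eventually_ge_atTop 1).mono fun N hN => towerRatio_le_s17 hq.two_le hN)
  have hlt : 5 / ε < q := hQ.trans_le (by exact_mod_cast hQq)
  exact hle.trans_lt ((div_lt_comm₀ hε hq0).mp hlt)
end

section
/- No odd squarefree positive integer belongs to M(2): if n is odd and squarefree, then n ∉ M(2). Consequently, d(2) ≤ 1 - 4/π². Moreover, since every even positive integer belongs to M(2), d(2) ≥ 1/2. -/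
open Filter Topology

theorem not_towerMem_one (q : ℕ) : ¬ TowerMem q 1 := by
  intro h
  cases h <;> omega

theorem not_towerMem_of_squarefree {q n : ℕ} (hq : ¬ q ∣ n) (hn : Squarefree n) :
    ¬ TowerMem q n := by
  intro h
  cases h with
  | base _ _ hdvd => exact hq hdvd
  | step _ p h2 hp hdvd hexp =>
    have h1 : n.factorization p = 1 :=
      le_antisymm (hn.natFactorization_le_one p) (hp.factorization_pos_of_dvd (by omega) hdvd)
    exact not_towerMem_one q (h1 ▸ hexp)

theorem towerMem_of_two_dvd {n : ℕ} (hn : 0 < n) (h : 2 ∣ n) : TowerMem 2 n :=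
  .base n (Nat.le_of_dvd hn h) h

theorem hasSum_one_div_odd_sq :
    HasSum (fun k : ℕ => 1 / ((2 * k + 1 : ℕ) : ℝ) ^ 2) (Real.pi ^ 2 / 8) := by
  have hz := hasSum_zeta_two
  have heven : HasSum (fun k : ℕ => 1 / ((2 * k : ℕ) : ℝ) ^ 2) (1 / 4 * (Real.pi ^ 2 / 6)) := by
    have h (k : ℕ) : 1 / ((2 * k : ℕ) : ℝ) ^ 2 = 1 / 4 * (1 / (k : ℝ) ^ 2) := by
      push_cast
      ring
    simpa only [h] using hz.mul_left (1 / 4)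
  have hodd : Summable (fun k : ℕ => 1 / ((2 * k + 1 : ℕ) : ℝ) ^ 2) :=
    hz.summable.comp_injective (i := fun k : ℕ => 2 * k + 1) fun a b h => by simpa using h
  have h := (HasSum.even_add_odd (f := fun n : ℕ => 1 / (n : ℝ) ^ 2) heven hodd.hasSum).unique hz
  have hsum := hodd.hasSum
  rwa [show ∑' k : ℕ, 1 / ((2 * k + 1 : ℕ) : ℝ) ^ 2 = Real.pi ^ 2 / 8 by linarith] at hsum

theorem tendsto_natCast_div_div_natCast {m : ℕ} (hm : 0 < m) :
    Tendsto (fun N : ℕ => ((N / m : ℕ) : ℝ) / N) atTop (𝓝 (1 / m)) := by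
  have h := (tendsto_nat_floor_mul_div_atTop (R := ℝ) (a := 1 / m) (by positivity)).comp
    tendsto_natCast_atTop_atTop
  refine h.congr fun N => ?_
  simp only [Function.comp_apply]
  rw [one_div_mul_eq_div, Nat.floor_div_eq_div]

open Classical in
/-- The number of integers in `{1, …, N}` that do not lie in `M(q)`. -/
noncomputable def nonTowerCount (q N : ℕ) : ℕ :=
  ((Finset.Icc 1 N).filter fun n => ¬ TowerMem q n).card

theorem nonTowerCount_le (q N : ℕ) : nonTowerCount q N ≤ N := by
  classical
  simpa [nonTowerCount] using
    Finset.card_filter_le (Finset.Icc 1 N) fun n => ¬ TowerMem q n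

theorem nonTowerCount_div (q : ℕ) {N : ℕ} (hN : 0 < N) :
    (nonTowerCount q N : ℝ) / N = 1 - towerRatio q N := by
  classical
  have h := Finset.card_filter_add_card_filter_not (s := Finset.Icc 1 N) (fun n => TowerMem q n)
  have h' : (((Finset.Icc 1 N).filter fun n => TowerMem q n).card : ℝ) + nonTowerCount q N = N := by
    rw [Nat.card_Icc, Nat.add_sub_cancel] at h
    unfold nonTowerCount
    exact_mod_cast h
  have hN' : (N : ℝ) ≠ 0 := by positivity
  unfold towerRatio
  field_simp
  linarith

theorem tendsto_nonTowerCount_div {q : ℕ} {d : ℝ} (hd : Tendsto (towerRatio q) atTop (𝓝 d))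
    {m : ℕ} (hm : 0 < m) :
    Tendsto (fun N : ℕ => (nonTowerCount q (N / m) : ℝ) / N) atTop (𝓝 ((1 - d) * (1 / m))) := by
  have h1 : Tendsto (fun N : ℕ => (nonTowerCount q N : ℝ) / N) atTop (𝓝 (1 - d)) := by
    refine (hd.const_sub 1).congr' ?_
    filter_upwards [eventually_gt_atTop 0] with N hN
    exact (nonTowerCount_div q hN).symm
  refine ((h1.comp (Nat.tendsto_div_const_atTop hm.ne')).mul
    (tendsto_natCast_div_div_natCast hm)).congr fun N => ?_
  simp only [Function.comp_apply]
  rcases Nat.eq_zero_or_pos (N / m) with h0 | h0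
  · simp [h0, Nat.le_zero.mp (nonTowerCount_le q 0)]
  · exact div_mul_div_cancel₀ (by positivity)

/-- Every odd number is an odd squarefree number times an odd square. -/
theorem half_le_sum_nonTowerCount (N : ℕ) :
    N / 2 ≤ ∑ k ∈ Finset.range N, nonTowerCount 2 (N / (2 * k + 1) ^ 2) := by
  classical
  have hcover : (Finset.range (N / 2)).image (fun k => 2 * k + 1) ⊆
      (Finset.range N).biUnion fun k =>
        ((Finset.Icc 1 (N / (2 * k + 1) ^ 2)).filter fun n => ¬ TowerMem 2 n).image
          fun a => (2 * k + 1) ^ 2 * a := by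
    intro n hn
    obtain ⟨j, hj, rfl⟩ := Finset.mem_image.mp hn
    rw [Finset.mem_range] at hj
    obtain ⟨a, b, ha, hb, hab, hsq⟩ := Nat.sq_mul_squarefree_of_pos (n := 2 * j + 1) (by omega)
    have hodd : Odd (b ^ 2 * a) := hab ▸ odd_two_mul_add_one j
    rw [Nat.odd_mul, Nat.odd_pow_iff two_ne_zero] at hodd
    obtain ⟨⟨k, rfl⟩, hao⟩ := hodd
    have hle : 2 * k + 1 ≤ 2 * j + 1 := by
      rw [← hab]
      nlinarith [Nat.zero_le k]
    simp only [Finset.mem_biUnion, Finset.mem_image, Finset.mem_filter, Finset.mem_range,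
      Finset.mem_Icc]
    refine ⟨k, by omega, a, ⟨⟨ha, ?_⟩, not_towerMem_of_squarefree hao.not_two_dvd_nat hsq⟩, hab⟩
    rw [Nat.le_div_iff_mul_le (by positivity), mul_comm, hab]
    omega
  calc N / 2 = ((Finset.range (N / 2)).image (fun k => 2 * k + 1)).card := by
        rw [Finset.card_image_of_injective _ fun a b h => by simpa using h, Finset.card_range]
    _ ≤ _ := Finset.card_le_card hcover
    _ ≤ _ := Finset.card_biUnion_le
    _ ≤ _ := Finset.sum_le_sum fun _ _ => Finset.card_image_le

theorem half_le_tower_density_two {d : ℝ} (hd : Tendsto (towerRatio 2) atTop (𝓝 d)) :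
    1 / 2 ≤ d := by
  classical
  refine le_of_tendsto_of_tendsto' (tendsto_natCast_div_div_natCast two_pos) hd fun N => ?_
  unfold towerRatio
  gcongr
  have hsub : (Finset.Icc 1 (N / 2)).image (fun k => 2 * k) ⊆
      (Finset.Icc 1 N).filter fun n => TowerMem 2 n := by
    intro n hn
    obtain ⟨k, hk, rfl⟩ := Finset.mem_image.mp hn
    rw [Finset.mem_Icc] at hk
    rw [Finset.mem_filter, Finset.mem_Icc]
    exact ⟨by omega, towerMem_of_two_dvd (by omega) (dvd_mul_right 2 k)⟩
  have h := Finset.card_le_card hsub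
  rw [Finset.card_image_of_injective _ fun a b h => by simpa using h, Nat.card_Icc,
    Nat.add_sub_cancel] at h
  convert h

theorem tower_density_two_le {d : ℝ} (hd : Tendsto (towerRatio 2) atTop (𝓝 d)) :
    d ≤ 1 - 4 / Real.pi ^ 2 := by
  have hlim : Tendsto
      (fun N : ℕ => ∑' k : ℕ, (nonTowerCount 2 (N / (2 * k + 1) ^ 2) : ℝ) / N) atTop
      (𝓝 (∑' k : ℕ, (1 - d) * (1 / ((2 * k + 1 : ℕ) : ℝ) ^ 2))) := by
    refine tendsto_tsum_of_dominated_convergence hasSum_one_div_odd_sq.summable (fun k => ?_)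
      (.of_forall fun N k => ?_)
    · exact_mod_cast tendsto_nonTowerCount_div hd (m := (2 * k + 1) ^ 2) (by positivity)
    · rw [Real.norm_of_nonneg (by positivity)]
      have h1 : (nonTowerCount 2 (N / (2 * k + 1) ^ 2) : ℝ) ≤ N / ((2 * k + 1 : ℕ) : ℝ) ^ 2 := by
        refine (Nat.cast_le.mpr (nonTowerCount_le _ _)).trans ?_
        exact_mod_cast Nat.cast_div_le (α := ℝ) (m := N) (n := (2 * k + 1) ^ 2)
      refine div_le_of_le_mul₀ (by positivity) (by positivity) ?_
      rwa [one_div_mul_eq_div]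
  rw [(hasSum_one_div_odd_sq.mul_left (1 - d)).tsum_eq] at hlim
  have hle : 1 / 2 ≤ (1 - d) * (Real.pi ^ 2 / 8) := by
    refine le_of_tendsto_of_tendsto' (tendsto_natCast_div_div_natCast two_pos) hlim fun N => ?_
    rw [tsum_eq_sum (s := Finset.range N), ← Finset.sum_div]
    · gcongr
      exact_mod_cast half_le_sum_nonTowerCount N
    · intro k hk
      rw [Finset.mem_range, not_lt] at hk
      have h0 : N / (2 * k + 1) ^ 2 = 0 := Nat.div_eq_of_lt (by nlinarith)
      have h1 := nonTowerCount_le 2 0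
      rw [h0, Nat.le_zero.mp h1]
      simp
  have hpi : 0 < Real.pi ^ 2 := by positivity
  have : 4 / Real.pi ^ 2 ≤ 1 - d := by
    rw [div_le_iff₀ hpi]
    linarith
  linarith

theorem tower_density_two_first_bounds (d : ℝ)
    (hd : Tendsto (towerRatio 2) atTop (𝓝 d)) :
    (∀ n : ℕ, 0 < n → Odd n → Squarefree n → ¬ TowerMem 2 n) ∧
    (∀ n : ℕ, 0 < n → 2 ∣ n → TowerMem 2 n) ∧
    d ≤ 1 - 4 / Real.pi ^ 2 ∧ 1 / 2 ≤ d :=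
  ⟨fun _ _ hodd hsq => not_towerMem_of_squarefree hodd.not_two_dvd_nat hsq,
    fun _ => towerMem_of_two_dvd, tower_density_two_le hd, half_le_tower_density_two hd⟩
end
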